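/- arXiv:1404.4715 — 2 statements merged into one kernel-verified Lean document; each statement's English description precedes it below -/
import Mathlib

section
/- Let K be a field with a surjective additive valuation v : K → ℝ∞. Let I_Y ⊆ K[x_1,…,x_n] be an ideal generated by homogeneous linear forms, fix weight vectors a_1,…,a_n ∈ ℤ^m, and let I_X := {F ∈ K[x_1,…,x_n] : F_β ∈ I_Y for all β ∈ ℤ^m} (the ideal of the closure of the torus orbit of the linear space Y; I_X is weight-homogeneous). Let X^an, Y^an be the analytifications attached to I_X and I_Y respectively, let Trop(X^0) := {ξ ∈ ℝ^n : ∃ w ∈ X^an with w(x̄_i) = ξ_i for all i} and Trop(Y^0) := {η ∈ ℝ^n : ∃ w ∈ Y^an with w(x̄_i) = η_i for all i}, both with the subspace topology of ℝ^n, and let μ : ℝ^m × X^an → X^an be defined using the weights a_i. Suppose there is a continuous map ξ ↦ (τ(ξ), η(ξ)) from Trop(X^0) to ℝ^m × Trop(Y^0) such that ξ_i = a_i·τ(ξ) + η(ξ)_i for all i and all ξ ∈ Trop(X^0). Then there exists a continuous map σ : Trop(X^0) → X^an with trop(σ(ξ)) = ξ for all ξ ∈ Trop(X^0). Moreover, if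 the map ξ ↦ (τ(ξ), η(ξ)) is ℝ^m-equivariant, i.e. τ(ξ + Aτ') = τ(ξ) + τ' and η(ξ + Aτ') = η(ξ) for all τ' ∈ ℝ^m (where (Aτ')_i := a_i·τ'), then σ can be chosen ℝ^m-equivariant: σ(ξ + Aτ') = μ(τ', σ(ξ)) for all ξ and τ'. -/
open scoped Classical

noncomputable section

/-- `ℝ∞ = ℝ ∪ {∞}`, with the order topology. -/
abbrev RInf := WithTop ℝ

noncomputable instance : TopologicalSpace RInf := Preorder.topology RInf
instance : OrderTopology RInf := ⟨rfl⟩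

/-- An additive (non-Archimedean) valuation on a commutative ring, with values in
`ℝ∞`: `w(ab) = w(a) + w(b)`, `w(a+b) ≥ min (w a) (w b)`, `w 1 = 0`, `w 0 = ∞`. -/
structure IsVal {R : Type*} [CommRing R] (w : R → RInf) : Prop where
  map_mul : ∀ a b, w (a * b) = w a + w b
  min_le_add : ∀ a b, min (w a) (w b) ≤ w (a + b)
  map_one : w 1 = 0
  map_zero : w 0 = ⊤

/-- The analytification of `Spec B`: the set of additive valuations on the `K`-algebra
`B` extending the valuation `v` on `K`, as a subset of the product space `B → ℝ∞`
(topology of pointwise convergence). -/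
def An {K : Type*} [Field K] (v : K → RInf) (B : Type*) [CommRing B] [Algebra K B] :
    Set (B → RInf) :=
  {w | IsVal w ∧ ∀ c : K, w (algebraMap K B c) = v c}

variable {K : Type*} [Field K] {ι M : Type*} [Fintype M]

/-- Weight of a monomial exponent `α` with respect to weight vectors `a`. -/
def wt (a : ι → M → ℤ) (α : ι →₀ ℕ) : M → ℤ :=
  α.sum fun i k => (k : ℤ) • a i

/-- The weight-`β` component `F_β` of a polynomial `F`: the sum of the terms `c·x^α`
of `F` with `Σ_i α_i a_i = β`. -/
def wtComp (a : ι → M → ℤ) (F : MvPolynomial ι K) (β : M → ℤ) : MvPolynomial ι K :=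
  ∑ α ∈ F.support.filter (fun α => wt a α = β), MvPolynomial.monomial α (F.coeff α)

/-- An ideal is weight-homogeneous if it contains all weight components of its
members. -/
def WtHomog (a : ι → M → ℤ) (I : Ideal (MvPolynomial ι K)) : Prop :=
  ∀ F ∈ I, ∀ β : M → ℤ, wtComp a F β ∈ I

/-- Pairing `β·τ` of an integer vector with a real vector. -/
def pairR (β : M → ℤ) (τ : M → ℝ) : ℝ := ∑ j, (β j : ℝ) * τ j

/-- `ν(F) = min_β (w(F̄_β) + β·τ)`: the minimum over the finitely many `β` with
`F_β ≠ 0`, with value `∞` for `F = 0`. -/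
def muAux (a : ι → M → ℤ) (I : Ideal (MvPolynomial ι K))
    (w : (MvPolynomial ι K ⧸ I) → RInf) (τ : M → ℝ) (F : MvPolynomial ι K) : RInf :=
  (F.support.image (wt a)).inf fun β =>
    w (Ideal.Quotient.mk I (wtComp a F β)) + ((pairR β τ : ℝ) : RInf)

/-- `μ(τ,w) : B → ℝ∞`, computed on an arbitrary lift of `f` (for weight-homogeneous
`I` this is independent of the lift). -/
def mu (a : ι → M → ℤ) (I : Ideal (MvPolynomial ι K)) (τ : M → ℝ)
    (w : (MvPolynomial ι K ⧸ I) → RInf) : (MvPolynomial ι K ⧸ I) → RInf :=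
  fun f => muAux a I w τ (Function.surjInv Ideal.Quotient.mk_surjective f)

/-- The tropicalisation map `X^an → ℝ∞^ι`, `w ↦ (w(x̄_i))_i`. -/
def tropMap (I : Ideal (MvPolynomial ι K)) (w : (MvPolynomial ι K ⧸ I) → RInf) :
    ι → RInf :=
  fun i => w (Ideal.Quotient.mk I (MvPolynomial.X i))

/-- `Trop(X)`: the image of the analytification under `trop`, inside `ℝ∞^ι`. -/
def TropSet (v : K → RInf) (I : Ideal (MvPolynomial ι K)) : Set (ι → RInf) :=
  {η | ∃ w ∈ An v (MvPolynomial ι K ⧸ I), tropMap I w = η}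

/-- `Trop(X⁰)`: the points of `Trop(X)` with all coordinates finite, inside `ℝ^ι`. -/
def TropSet0 (v : K → RInf) (I : Ideal (MvPolynomial ι K)) : Set (ι → ℝ) :=
  {ξ | ∃ w ∈ An v (MvPolynomial ι K ⧸ I), ∀ i, tropMap I w i = ((ξ i : ℝ) : RInf)}

end

namespace RInf

theorem coe_lt_add_coe_iff (m r : ℝ) (x : RInf) :
    (m : RInf) < x + (r : RInf) ↔ ((m - r : ℝ) : RInf) < x := by
  induction x using WithTop.recTopCoe with
  | top => exact iff_of_true (by simp) (WithTop.coe_lt_top _)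
  | coe x => norm_cast; exact sub_lt_iff_lt_add.symm

theorem add_coe_lt_coe_iff (m r : ℝ) (x : RInf) :
    x + (r : RInf) < (m : RInf) ↔ x < ((m - r : ℝ) : RInf) := by
  induction x using WithTop.recTopCoe with
  | top => simp
  | coe x => norm_cast; exact lt_sub_iff_add_lt.symm

theorem min_add_coe (x y : RInf) (r : ℝ) :
    min x y + (r : RInf) = min (x + r) (y + r) :=
  (show Monotone fun z : RInf => z + (r : RInf) from fun _ _ h => add_le_add_left h _).map_min

theorem inf_add_coe {α : Type*} (s : Finset α) (f : α → RInf) (r : ℝ) :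
    s.inf f + (r : RInf) = s.inf fun i => f i + (r : RInf) :=
  Finset.apply_inf_eq_inf_comp (fun z : RInf => z + (r : RInf))
    (fun x y => min_add_coe x y r) (by simp)

theorem continuous_add_coe {T : Type*} [TopologicalSpace T] {f : T → RInf} {r : T → ℝ}
    (hf : Continuous f) (hr : Continuous r) : Continuous fun t => f t + (r t : RInf) := by
  rw [continuous_iff_continuousAt]
  intro t
  refine tendsto_order.2 ⟨fun b hb => ?_, fun b hb => ?_⟩
  · induction b using WithTop.recTopCoe with
    | top => exact absurd hb not_top_lt
    | coe b =>
      obtain ⟨c, hbc, hc⟩ := exists_between ((coe_lt_add_coe_iff _ _ _).1 hb)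
      lift c to ℝ using hc.ne_top
      have hbc' : b - c < r t := by linarith [WithTop.coe_lt_coe.1 hbc]
      filter_upwards [hf.continuousAt.eventually_const_lt hc,
        hr.continuousAt.eventually_const_lt hbc'] with s hs hs'
      rw [coe_lt_add_coe_iff]
      exact lt_trans (WithTop.coe_lt_coe.2 (by linarith)) hs
  · induction b using WithTop.recTopCoe with
    | top =>
      have hft : f t < ⊤ := lt_of_le_of_ne le_top (by rintro h; simp [h] at hb)
      filter_upwards [hf.continuousAt.eventually_lt_const hft] with s hs
      exact WithTop.add_lt_top.2 ⟨hs, WithTop.coe_lt_top _⟩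
    | coe b =>
      obtain ⟨c, hc, hbc⟩ := exists_between ((add_coe_lt_coe_iff _ _ _).1 hb)
      lift c to ℝ using hbc.ne_top
      have hbc' : r t < b - c := by linarith [WithTop.coe_lt_coe.1 hbc]
      filter_upwards [hf.continuousAt.eventually_lt_const hc,
        hr.continuousAt.eventually_lt_const hbc'] with s hs hs'
      rw [add_coe_lt_coe_iff]
      exact lt_trans hs (WithTop.coe_lt_coe.2 (by linarith))

end RInf

namespace IsVal

variable {R S : Type*} [CommRing R] [CommRing S] {w : R → RInf}

theorem comp (hw : IsVal w) (φ : S →+* R) : IsVal fun x => w (φ x) where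
  map_mul a b := by simp [hw.map_mul]
  min_le_add a b := by simpa using hw.min_le_add (φ a) (φ b)
  map_one := by simp [hw.map_one]
  map_zero := by simp [hw.map_zero]

theorem map_neg (hw : IsVal w) (x : R) : w (-x) = w x :=
  (AddValuation.of w hw.map_zero hw.map_one hw.min_le_add hw.map_mul).map_neg x

theorem map_pow (hw : IsVal w) (x : R) (k : ℕ) : w (x ^ k) = k • w x :=
  (AddValuation.of w hw.map_zero hw.map_one hw.min_le_add hw.map_mul).map_pow x k

theorem le_add_coe (hw : IsVal w) {m : RInf} {r : ℝ} {x y : R}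
    (hx : m ≤ w x + (r : RInf)) (hy : m ≤ w y + (r : RInf)) : m ≤ w (x + y) + (r : RInf) :=
  (le_min hx hy).trans <| (RInf.min_add_coe _ _ _).symm.trans_le <| by
    gcongr; exact hw.min_le_add x y

theorem lt_add_coe (hw : IsVal w) {m : RInf} {r : ℝ} {x y : R}
    (hx : m < w x + (r : RInf)) (hy : m < w y + (r : RInf)) : m < w (x + y) + (r : RInf) :=
  (lt_min hx hy).trans_le <| (RInf.min_add_coe _ _ _).symm.trans_le <| by
    gcongr; exact hw.min_le_add x y

theorem le_sum (hw : IsVal w) {α : Type*} {s : Finset α} {f : α → R} {m : RInf}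
    (h : ∀ i ∈ s, m ≤ w (f i)) : m ≤ w (∑ i ∈ s, f i) :=
  Finset.sum_induction f (fun x => m ≤ w x)
    (fun x y hx hy => (le_min hx hy).trans (hw.min_le_add x y)) (by simp [hw.map_zero]) h

theorem eq_of_sub_eq_top (hw : IsVal w) {x y : R} (h : w (x - y) = ⊤) : w x = w y := by
  have h' : w (y - x) = ⊤ := by rw [← neg_sub, hw.map_neg, h]
  refine le_antisymm ?_ ?_
  · simpa [h'] using hw.min_le_add x (y - x)
  · simpa [h] using hw.min_le_add y (x - y)

theorem ne_top {F : Type*} [Field F] {v : F → RInf} (hv : IsVal v) {c : F} (hc : c ≠ 0) :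
    v c ≠ ⊤ := by
  intro h
  have := hv.map_mul c c⁻¹
  rw [mul_inv_cancel₀ hc, hv.map_one, h] at this
  simp at this

end IsVal

section Gauss

open AddMonoidAlgebra

variable {R A : Type*} [CommRing R] [AddCommMonoid A]

/-- The Gauss extension of `w` to the monoid algebra, with value `ℓ a` on the monomial `a`. -/
noncomputable def gaussVal (w : R → RInf) (ℓ : A →+ ℝ) (f : AddMonoidAlgebra R A) : RInf :=
  f.coeff.support.inf fun a => w (f.coeff a) + (ℓ a : RInf)

variable {w : R → RInf} {ℓ : A →+ ℝ}

theorem le_gaussVal_iff (hw : IsVal w) {f : AddMonoidAlgebra R A} {m : RInf} :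
    m ≤ gaussVal w ℓ f ↔ ∀ a, m ≤ w (f.coeff a) + (ℓ a : RInf) := by
  rw [gaussVal, Finset.le_inf_iff]
  refine ⟨fun h a => ?_, fun h a _ => h a⟩
  by_cases ha : a ∈ f.coeff.support
  · exact h a ha
  · simp [Finsupp.notMem_support_iff.1 ha, hw.map_zero]

theorem gaussVal_le (hw : IsVal w) (f : AddMonoidAlgebra R A) (a : A) :
    gaussVal w ℓ f ≤ w (f.coeff a) + (ℓ a : RInf) :=
  (le_gaussVal_iff hw).1 le_rfl a

theorem gaussVal_single (hw : IsVal w) (a : A) (r : R) :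
    gaussVal w ℓ (single a r) = w r + (ℓ a : RInf) := by
  refine le_antisymm ((gaussVal_le hw _ a).trans_eq (by simp)) ((le_gaussVal_iff hw).2 fun b => ?_)
  by_cases h : a = b
  · subst h; simp
  · simp [Finsupp.single_eq_of_ne' h, hw.map_zero]

theorem exists_eq_gaussVal {f : AddMonoidAlgebra R A} (h : gaussVal w ℓ f ≠ ⊤) :
    ∃ a ∈ f.coeff.support, w (f.coeff a) + (ℓ a : RInf) = gaussVal w ℓ f := by
  rcases f.coeff.support.eq_empty_or_nonempty with h0 | h0
  · simp [gaussVal, h0] at h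
  · obtain ⟨a, ha, h'⟩ := Finset.exists_mem_eq_inf _ h0 fun a => w (f.coeff a) + (ℓ a : RInf)
    exact ⟨a, ha, h'.symm⟩

theorem le_gaussVal_mul (hw : IsVal w) (f g : AddMonoidAlgebra R A) :
    gaussVal w ℓ f + gaussVal w ℓ g ≤ gaussVal w ℓ (f * g) := by
  refine (le_gaussVal_iff hw).2 fun c => ?_
  rw [coeff_mul]
  refine Finset.sum_induction _ (fun x => _ ≤ w x + (ℓ c : RInf)) (fun _ _ => hw.le_add_coe)
    (by simp [hw.map_zero]) fun a _ => ?_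
  refine Finset.sum_induction _ (fun x => _ ≤ w x + (ℓ c : RInf)) (fun _ _ => hw.le_add_coe)
    (by simp [hw.map_zero]) fun b _ => ?_
  beta_reduce
  split_ifs with h
  · subst h
    rw [hw.map_mul, map_add, WithTop.coe_add, add_add_add_comm]
    exact add_le_add (gaussVal_le hw f a) (gaussVal_le hw g b)
  · simp [hw.map_zero]

theorem gaussVal_mul_le [UniqueSums A] (hw : IsVal w) (f g : AddMonoidAlgebra R A) :
    gaussVal w ℓ (f * g) ≤ gaussVal w ℓ f + gaussVal w ℓ g := by
  by_cases hf : gaussVal w ℓ f = ⊤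
  · simp [hf]
  by_cases hg : gaussVal w ℓ g = ⊤
  · simp [hg]
  let S := f.coeff.support.filter fun a => w (f.coeff a) + (ℓ a : RInf) = gaussVal w ℓ f
  let T := g.coeff.support.filter fun a => w (g.coeff a) + (ℓ a : RInf) = gaussVal w ℓ g
  have hS : S.Nonempty := by
    obtain ⟨a, ha, h⟩ := exists_eq_gaussVal hf
    exact ⟨a, Finset.mem_filter.2 ⟨ha, h⟩⟩
  have hT : T.Nonempty := by
    obtain ⟨a, ha, h⟩ := exists_eq_gaussVal hg
    exact ⟨a, Finset.mem_filter.2 ⟨ha, h⟩⟩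
  obtain ⟨a₀, ha₀, b₀, hb₀, huniq⟩ := UniqueSums.uniqueAdd_of_nonempty hS hT
  obtain ⟨ha₀s, ha₀v⟩ := Finset.mem_filter.1 ha₀
  obtain ⟨hb₀s, hb₀v⟩ := Finset.mem_filter.1 hb₀
  have hlt : ∀ a ∈ f.coeff.support, ∀ b ∈ g.coeff.support, a + b = a₀ + b₀ →
      ¬ (a = a₀ ∧ b = b₀) → gaussVal w ℓ f + gaussVal w ℓ g
        < w (f.coeff a * g.coeff b) + (ℓ (a₀ + b₀) : RInf) := by
    intro a ha b hb hab hne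
    rw [← hab, hw.map_mul, map_add, WithTop.coe_add, add_add_add_comm]
    by_cases haS : a ∈ S
    · have hbT : b ∉ T := fun hbT => hne (huniq haS hbT hab)
      refine WithTop.add_lt_add_of_le_of_lt hf (gaussVal_le hw f a)
        (lt_of_le_of_ne (gaussVal_le hw g b) fun h => hbT (Finset.mem_filter.2 ⟨hb, h.symm⟩))
    · exact WithTop.add_lt_add_of_lt_of_le hg (lt_of_le_of_ne (gaussVal_le hw f a)
        fun h => haS (Finset.mem_filter.2 ⟨ha, h.symm⟩)) (gaussVal_le hw g b)
  have hlead : w (f.coeff a₀ * g.coeff b₀) + (ℓ (a₀ + b₀) : RInf)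
      = gaussVal w ℓ f + gaussVal w ℓ g := by
    rw [hw.map_mul, map_add, WithTop.coe_add, add_add_add_comm, ha₀v, hb₀v]
  have htop : gaussVal w ℓ f + gaussVal w ℓ g < (⊤ : RInf) :=
    WithTop.add_lt_top.2 ⟨lt_top_iff_ne_top.2 hf, lt_top_iff_ne_top.2 hg⟩
  by_contra! hcon
  have hcoeff := hcon.trans_le (gaussVal_le hw (f * g) (a₀ + b₀))
  have hsum : (f * g).coeff (a₀ + b₀) = f.coeff a₀ * g.coeff b₀ +
      ∑ p ∈ (f.coeff.support ×ˢ g.coeff.support).erase (a₀, b₀),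
        if p.1 + p.2 = a₀ + b₀ then f.coeff p.1 * g.coeff p.2 else 0 := by
    rw [coeff_mul, Finsupp.sum]
    simp only [Finsupp.sum]
    rw [← Finset.sum_product', ← Finset.add_sum_erase _ _ (Finset.mk_mem_product ha₀s hb₀s)]
    simp
  have hrest : gaussVal w ℓ f + gaussVal w ℓ g <
      w (∑ p ∈ (f.coeff.support ×ˢ g.coeff.support).erase (a₀, b₀),
        if p.1 + p.2 = a₀ + b₀ then f.coeff p.1 * g.coeff p.2 else 0)
        + (ℓ (a₀ + b₀) : RInf) := by
    refine Finset.sum_induction _ (fun x => _ < w x + (ℓ (a₀ + b₀) : RInf))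
      (fun _ _ => hw.lt_add_coe) (by simpa [hw.map_zero] using htop) fun p hp => ?_
    obtain ⟨hne, hp⟩ := Finset.mem_erase.1 hp
    obtain ⟨h₁, h₂⟩ := Finset.mem_product.1 hp
    split_ifs with h
    · exact hlt _ h₁ _ h₂ h fun h => hne (Prod.ext h.1 h.2)
    · simpa [hw.map_zero] using htop
  rw [← hw.map_neg] at hrest
  have := hw.lt_add_coe hcoeff hrest
  rw [hsum, add_neg_cancel_right, hlead] at this
  exact lt_irrefl _ this

theorem isVal_gaussVal [UniqueSums A] (hw : IsVal w) : IsVal (gaussVal w ℓ) where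
  map_mul f g := le_antisymm (gaussVal_mul_le hw f g) (le_gaussVal_mul hw f g)
  min_le_add f g := (le_gaussVal_iff hw).2 fun a => by
    rw [coeff_add, Finsupp.add_apply]
    exact hw.le_add_coe ((min_le_left _ _).trans (gaussVal_le hw f a))
      ((min_le_right _ _).trans (gaussVal_le hw g a))
  map_one := by rw [one_def, gaussVal_single hw]; simp [hw.map_one]
  map_zero := by simp [gaussVal]

end Gauss

section Quotient

variable {R : Type*} [CommRing R] {I : Ideal R} {u : R → RInf}

/-- A function on `R`, evaluated on chosen representatives of the classes modulo `I`. -/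
noncomputable def quotVal (I : Ideal R) (u : R → RInf) (f : R ⧸ I) : RInf :=
  u (Function.surjInv Ideal.Quotient.mk_surjective f)

theorem quotVal_mk (hu : IsVal u) (hI : ∀ x ∈ I, u x = ⊤) (x : R) :
    quotVal I u (Ideal.Quotient.mk I x) = u x :=
  hu.eq_of_sub_eq_top <| hI _ <| Ideal.Quotient.eq.1 <| Function.surjInv_eq _ _

theorem isVal_quotVal (hu : IsVal u) (hI : ∀ x ∈ I, u x = ⊤) : IsVal (quotVal I u) where
  map_mul f g := by
    obtain ⟨x, rfl⟩ := Ideal.Quotient.mk_surjective f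
    obtain ⟨y, rfl⟩ := Ideal.Quotient.mk_surjective g
    simp only [← _root_.map_mul, quotVal_mk hu hI, hu.map_mul]
  min_le_add f g := by
    obtain ⟨x, rfl⟩ := Ideal.Quotient.mk_surjective f
    obtain ⟨y, rfl⟩ := Ideal.Quotient.mk_surjective g
    simp only [← _root_.map_add, quotVal_mk hu hI, hu.min_le_add]
  map_one := by rw [← _root_.map_one (Ideal.Quotient.mk I), quotVal_mk hu hI, hu.map_one]
  map_zero := by rw [← _root_.map_zero (Ideal.Quotient.mk I), quotVal_mk hu hI, hu.map_zero]

end Quotient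

section Torus

open MvPolynomial

variable {K : Type*} [Field K] {ι M : Type*}

/-- The coaction `x_i ↦ t^{a_i} x_i` of the torus on the polynomial ring. -/
noncomputable def torusHom (a : ι → M → ℤ) :
    MvPolynomial ι K →ₐ[K] AddMonoidAlgebra (MvPolynomial ι K) (M → ℤ) :=
  aeval fun i => AddMonoidAlgebra.single (a i) (X i)

theorem torusHom_monomial (a : ι → M → ℤ) (α : ι →₀ ℕ) (c : K) :
    torusHom a (monomial α c) = AddMonoidAlgebra.single (wt a α) (monomial α c) := by
  rw [torusHom, aeval_monomial, AddMonoidAlgebra.coe_algebraMap, Function.comp_apply]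
  simp only [AddMonoidAlgebra.single_pow, AddMonoidAlgebra.finsuppProd_single,
    AddMonoidAlgebra.single_mul_single, zero_add, monomial_eq, wt, natCast_zsmul]
  rfl

variable [Fintype M]

theorem coeff_torusHom (a : ι → M → ℤ) (F : MvPolynomial ι K) (β : M → ℤ) :
    (torusHom a F).coeff β = wtComp a F β := by
  conv_lhs => rw [F.as_sum, map_sum]
  simp only [torusHom_monomial, AddMonoidAlgebra.coeff_sum, Finsupp.finsetSum_apply,
    AddMonoidAlgebra.coeff_single, Finsupp.single_apply, wtComp, Finset.sum_filter]

theorem torusHom_wtComp (a : ι → M → ℤ) (F : MvPolynomial ι K) (β : M → ℤ) :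
    torusHom a (wtComp a F β) = AddMonoidAlgebra.single β (wtComp a F β) := by
  rw [← AddMonoidAlgebra.singleAddHom_apply, wtComp, map_sum, map_sum]
  refine Finset.sum_congr rfl fun α hα => ?_
  rw [torusHom_monomial, (Finset.mem_filter.1 hα).2, AddMonoidAlgebra.singleAddHom_apply]

theorem wtComp_eq_zero {a : ι → M → ℤ} {F : MvPolynomial ι K} {β : M → ℤ}
    (h : β ∉ F.support.image (wt a)) : wtComp a F β = 0 := by
  rw [wtComp, Finset.filter_eq_empty_iff.2, Finset.sum_empty]
  rintro α hα rfl
  exact h (Finset.mem_image_of_mem _ hα)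

/-- The pairing with a fixed real vector as an additive map. -/
def pairHom (τ : M → ℝ) : (M → ℤ) →+ ℝ where
  toFun β := pairR β τ
  map_zero' := by simp [pairR]
  map_add' β γ := by simp [pairR, add_mul, Finset.sum_add_distrib]

@[simp]
theorem pairHom_apply (τ : M → ℝ) (β : M → ℤ) : pairHom τ β = pairR β τ := rfl

theorem pairR_add (β : M → ℤ) (τ τ' : M → ℝ) : pairR β (τ + τ') = pairR β τ + pairR β τ' := by
  simp [pairR, mul_add, Finset.sum_add_distrib]

theorem continuous_pairR (β : M → ℤ) : Continuous (pairR β) := by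
  unfold pairR; fun_prop

theorem muAux_eq_gaussVal (a : ι → M → ℤ) {I : Ideal (MvPolynomial ι K)}
    {w : (MvPolynomial ι K ⧸ I) → RInf} (hw : IsVal w) (τ : M → ℝ) (F : MvPolynomial ι K) :
    muAux a I w τ F
      = gaussVal (fun G => w (Ideal.Quotient.mk I G)) (pairHom τ) (torusHom a F) := by
  have hw' : IsVal fun G => w (Ideal.Quotient.mk I G) := hw.comp (Ideal.Quotient.mk I)
  refine le_antisymm ((le_gaussVal_iff hw').2 fun β => ?_)
    (Finset.le_inf_iff.2 fun β _ => ?_)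
  · rw [coeff_torusHom, pairHom_apply]
    by_cases h : β ∈ F.support.image (wt a)
    · exact Finset.inf_le (f := fun β =>
        w (Ideal.Quotient.mk I (wtComp a F β)) + ((pairR β τ : ℝ) : RInf)) h
    · simp [wtComp_eq_zero h, hw.map_zero]
  · have h := gaussVal_le (ℓ := pairHom τ) hw' (torusHom a F) β
    rwa [coeff_torusHom, pairHom_apply] at h

/-- The pullback along the torus coaction of the Gauss extension of `w` with weight `τ`. -/
noncomputable def smear (a : ι → M → ℤ) (w : MvPolynomial ι K → RInf) (τ : M → ℝ)
    (F : MvPolynomial ι K) : RInf :=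
  gaussVal w (pairHom τ) (torusHom a F)

variable {a : ι → M → ℤ} {w : MvPolynomial ι K → RInf}

theorem isVal_smear (hw : IsVal w) (τ : M → ℝ) : IsVal (smear a w τ) :=
  (isVal_gaussVal (ℓ := pairHom τ) hw).comp (torusHom (K := K) a).toRingHom

theorem smear_eq_top {I : Ideal (MvPolynomial ι K)} (hI : ∀ F ∈ I, w F = ⊤) (τ : M → ℝ)
    {F : MvPolynomial ι K} (hF : ∀ β, wtComp a F β ∈ I) : smear a w τ F = ⊤ :=
  (Finset.inf_eq_top_iff _ _).2 fun β _ => by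
    rw [coeff_torusHom, hI _ (hF β), top_add]

theorem smear_C (hw : IsVal w) (τ : M → ℝ) (c : K) : smear a w τ (C c) = w (C c) := by
  rw [smear, C_apply, torusHom_monomial, gaussVal_single hw]
  simp [wt, pairR]

theorem smear_X (hw : IsVal w) (τ : M → ℝ) (i : ι) :
    smear a w τ (X i) = w (X i) + (pairR (a i) τ : RInf) := by
  rw [smear, torusHom, aeval_X, gaussVal_single hw, pairHom_apply]

theorem smear_wtComp (hw : IsVal w) (τ : M → ℝ) (F : MvPolynomial ι K) (β : M → ℤ) :
    smear a w τ (wtComp a F β) = w (wtComp a F β) + (pairR β τ : RInf) := by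
  rw [smear, torusHom_wtComp, gaussVal_single hw, pairHom_apply]

theorem smear_add (hw : IsVal w) (τ τ' : M → ℝ) (F : MvPolynomial ι K) :
    smear a w (τ + τ') F = smear a (smear a w τ) τ' F := by
  refine Finset.inf_congr rfl fun β _ => ?_
  rw [coeff_torusHom, smear_wtComp hw, pairHom_apply, pairHom_apply, pairR_add, WithTop.coe_add,
    add_assoc]

theorem continuous_smear {T : Type*} [TopologicalSpace T] {s : T → MvPolynomial ι K → RInf}
    (hs : ∀ F, Continuous fun t => s t F) {τ : T → M → ℝ} (hτ : Continuous τ)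
    (F : MvPolynomial ι K) : Continuous fun t => smear a (s t) (τ t) F :=
  Continuous.finset_inf_apply fun β _ =>
    RInf.continuous_add_coe (hs _) ((continuous_pairR β).comp hτ)

end Torus

section Linear

open MvPolynomial

variable {K : Type*} [Field K] {v : K → RInf} {ι : Type*} [Fintype ι]

/-- The degree of exponents with respect to a real weight vector, as an additive map. -/
def weightHom (η : ι → ℝ) : (ι →₀ ℕ) →+ ℝ where
  toFun α := ∑ i, (α i : ℝ) * η i
  map_zero' := by simp
  map_add' α β := by simp [add_mul, Finset.sum_add_distrib]

theorem weightHom_single (η : ι → ℝ) (i : ι) : weightHom η (Finsupp.single i 1) = η i := by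
  simp [weightHom, Finsupp.single_apply]

/-- The weighted Gauss valuation on a polynomial ring. -/
noncomputable def gaussPoly (v : K → RInf) (η : ι → ℝ) (F : MvPolynomial ι K) : RInf :=
  gaussVal v (weightHom η) F

theorem isVal_gaussPoly (hv : IsVal v) (η : ι → ℝ) : IsVal (gaussPoly v η) :=
  isVal_gaussVal hv

theorem gaussPoly_C (hv : IsVal v) (η : ι → ℝ) (c : K) : gaussPoly v η (C c) = v c :=
  (gaussVal_single hv 0 c).trans (by simp)

theorem gaussPoly_X (hv : IsVal v) (η : ι → ℝ) (i : ι) :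
    gaussPoly v η (X i) = (η i : RInf) :=
  (gaussVal_single hv (Finsupp.single i 1) 1).trans (by rw [hv.map_one, weightHom_single, zero_add])

theorem gaussPoly_le {u : MvPolynomial ι K → RInf} {η : ι → ℝ} (hu : IsVal u)
    (huC : ∀ c, u (C c) = v c) (huX : ∀ i, (η i : RInf) ≤ u (X i)) (F : MvPolynomial ι K) :
    gaussPoly v η F ≤ u F := by
  conv_rhs => rw [F.as_sum]
  refine hu.le_sum fun α hα => ?_
  have hprod : (weightHom η α : RInf) ≤ u (∏ i, X i ^ α i) := by
    have : ∀ s : Finset ι, ((∑ i ∈ s, (α i : ℝ) * η i : ℝ) : RInf) ≤ u (∏ i ∈ s, X i ^ α i) := by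
      intro s
      induction s using Finset.induction_on with
      | empty => simp [hu.map_one]
      | insert i s hi ih =>
        rw [Finset.sum_insert hi, Finset.prod_insert hi, hu.map_mul, hu.map_pow, WithTop.coe_add,
          ← nsmul_eq_mul, WithTop.coe_nsmul]
        exact add_le_add (nsmul_le_nsmul_right (huX i) _) ih
    exact this Finset.univ
  have hmon : monomial α (F.coeff α) = C (F.coeff α) * ∏ i, X i ^ α i := by
    rw [monomial_eq, Finsupp.prod_fintype _ _ fun i => pow_zero _]
  rw [hmon, hu.map_mul, huC]
  exact (Finset.inf_le (f := fun β => v (F.coeff β) + (weightHom η β : RInf)) hα).trans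
    (add_le_add_right hprod _)

theorem continuous_gaussPoly (v : K → RInf) (F : MvPolynomial ι K) :
    Continuous fun η : ι → ℝ => gaussPoly v η F :=
  Continuous.finset_inf_apply fun α _ =>
    RInf.continuous_add_coe continuous_const (by
      change Continuous fun η : ι → ℝ => ∑ i, (α i : ℝ) * η i
      fun_prop)

/-- The linear substitution `x_i ↦ ∑_b c_{ib} x_b`. -/
noncomputable def linSub (c : ι → ι → K) : MvPolynomial ι K →ₐ[K] MvPolynomial ι K :=
  aeval fun i => ∑ b, C (c i b) * X b

/-- The coordinates in `B` form a basis of the linear forms modulo `I`, and the matrix `c`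
expresses the coordinates in terms of this basis. -/
structure IsCoordBasis (I : Ideal (MvPolynomial ι K)) (B : Finset ι) (c : ι → ι → K) : Prop where
  eq_zero : ∀ i, ∀ b ∉ B, c i b = 0
  sub_mem : ∀ i, X i - ∑ b, C (c i b) * X b ∈ I
  indep : ∀ d : ι → K, (∀ b ∉ B, d b = 0) → ∑ b, C (d b) * X b ∈ I → d = 0

variable {I : Ideal (MvPolynomial ι K)} {B : Finset ι} {c : ι → ι → K}

theorem IsCoordBasis.unique {c' : ι → ι → K} (hc : IsCoordBasis I B c)
    (hc' : IsCoordBasis I B c') : c = c' := by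
  funext i
  refine sub_eq_zero.1 (hc.indep _ (fun b hb => ?_) ?_)
  · simp [hc.eq_zero i b hb, hc'.eq_zero i b hb]
  · have := I.sub_mem (hc'.sub_mem i) (hc.sub_mem i)
    rw [sub_sub_sub_cancel_left] at this
    simpa [sub_mul, Finset.sum_sub_distrib] using this

theorem finite_isCoordBasis (I : Ideal (MvPolynomial ι K)) :
    {c : ι → ι → K | ∃ B, IsCoordBasis I B c}.Finite := by
  have : {c : ι → ι → K | ∃ B, IsCoordBasis I B c} = ⋃ B, {c | IsCoordBasis I B c} := by
    ext; simp
  rw [this]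
  exact Set.finite_iUnion fun B =>
    Set.Subsingleton.finite fun c hc c' hc' => IsCoordBasis.unique hc hc'

theorem IsCoordBasis.sub_linSub_mem (hc : IsCoordBasis I B c) (F : MvPolynomial ι K) :
    F - linSub c F ∈ I := by
  have : Ideal.Quotient.mkₐ K I = (Ideal.Quotient.mkₐ K I).comp (linSub c) := by
    refine algHom_ext fun i => ?_
    simpa [linSub] using Ideal.Quotient.eq.2 (hc.sub_mem i)
  exact Ideal.Quotient.eq.1 (DFunLike.congr_fun this F)

theorem IsCoordBasis.linSub_eq_zero (hc : IsCoordBasis I B c)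
    (hlin : ∃ S : Set (MvPolynomial ι K), (∀ F ∈ S, F.IsHomogeneous 1) ∧ I = Ideal.span S)
    {F : MvPolynomial ι K} (hF : F ∈ I) : linSub c F = 0 := by
  obtain ⟨S, hS, hI⟩ := hlin
  suffices h : I ≤ RingHom.ker (linSub c) from h hF
  conv_lhs => rw [hI]
  refine Ideal.span_le.2 fun G hG => ?_
  have hGI : G ∈ I := hI ▸ Ideal.subset_span hG
  have hlinG := hS G hG
  rw [← mem_homogeneousSubmodule, homogeneousSubmodule_one_eq_span_X,
    Submodule.mem_span_range_iff_exists_fun] at hlinG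
  obtain ⟨d, hd⟩ := hlinG
  have hsub : linSub c G = ∑ b, C (∑ i, d i * c i b) * X b := by
    simp only [← hd, linSub, map_sum, map_smul, aeval_X]
    simp only [smul_eq_C_mul, Finset.mul_sum, Finset.sum_mul, C_mul, mul_assoc]
    exact Finset.sum_comm
  have hmem : linSub c G ∈ I := by
    have := I.sub_mem hGI (hc.sub_linSub_mem G)
    rwa [sub_sub_cancel] at this
  rw [hsub] at hmem
  have hzero := hc.indep _ (fun b hb => by simp [hc.eq_zero _ b hb]) hmem
  change linSub c G = 0
  rw [hsub]
  exact Finset.sum_eq_zero fun b _ => by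
    rw [show ∑ i, d i * c i b = 0 from congr_fun hzero b, C_0, zero_mul]

/-- For every weight vector some coordinate basis has all reductions of coordinates of maximal
possible weight. -/
theorem exists_isCoordBasis_le (hv : IsVal v) (I : Ideal (MvPolynomial ι K)) (η : ι → ℝ) :
    ∃ B c, IsCoordBasis I B c ∧ ∀ i b, (η i : RInf) ≤ v (c i b) + (η b : RInf) := by
  let P : Finset ι → Prop := fun B => ∃ c : ι → ι → K, (∀ i, ∀ b ∉ B, c i b = 0) ∧
    (∀ i, X i - ∑ b, C (c i b) * X b ∈ I) ∧ ∀ i b, (η i : RInf) ≤ v (c i b) + (η b : RInf)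
  have huniv : P Finset.univ := by
    refine ⟨fun i b => if i = b then 1 else 0, by simp, fun i => ?_, fun i b => ?_⟩
    · have : ∑ b, C (if i = b then (1 : K) else 0) * X b = X i := by
        rw [Finset.sum_eq_single i] <;> simp +contextual [eq_comm]
      rw [this, sub_self]
      exact I.zero_mem
    · dsimp only
      split_ifs with h
      · simp [h, hv.map_one]
      · simp [hv.map_zero]
  obtain ⟨B, hB⟩ := (Set.toFinite {B | P B}).exists_minimal ⟨_, huniv⟩
  obtain ⟨c, hc₀, hcI, hcη⟩ := hB.prop
  refine ⟨B, c, ⟨hc₀, hcI, fun d hd hdI => ?_⟩, hcη⟩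
  by_contra hne
  have hsupp : (Finset.univ.filter fun b => d b ≠ 0).Nonempty := by
    obtain ⟨b, hb⟩ := Function.ne_iff.1 hne
    exact ⟨b, by simpa using hb⟩
  obtain ⟨b₀, hb₀, hmin⟩ := Finset.exists_min_image _ (fun b => v (d b) + (η b : RInf)) hsupp
  have hdb₀ : d b₀ ≠ 0 := (Finset.mem_filter.1 hb₀).2
  have hb₀B : b₀ ∈ B := by
    by_contra h
    exact hdb₀ (hd b₀ h)
  have hratio : ∀ b, (η b₀ : RInf) ≤ v (d b / d b₀) + (η b : RInf) := by
    intro b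
    by_cases hb : d b = 0
    · simp [hb, hv.map_zero]
    have h := hmin b (by simpa using hb)
    rw [show v (d b) = v (d b₀) + v (d b / d b₀) by
      rw [← hv.map_mul, mul_div_cancel₀ _ hdb₀], add_assoc] at h
    exact (WithTop.add_le_add_iff_left (hv.ne_top hdb₀)).1 h
  have hsmaller : P (B.erase b₀) := by
    refine ⟨fun i b => c i b + -(c i b₀ * (d b / d b₀)), fun i b hb => ?_, fun i => ?_,
      fun i b => ?_⟩
    · by_cases h : b = b₀
      · simp [h, hdb₀]
      · have hbB : b ∉ B := fun h' => hb (Finset.mem_erase.2 ⟨h, h'⟩)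
        simp [hc₀ i b hbB, hd b hbB]
    · have hmem := I.add_mem (hcI i) (I.mul_mem_left (C (c i b₀ / d b₀)) hdI)
      convert hmem using 1
      rw [Finset.mul_sum, sub_add, ← Finset.sum_sub_distrib]
      congr 1
      refine Finset.sum_congr rfl fun b _ => ?_
      rw [← mul_assoc, ← C_mul, ← sub_mul, ← C_sub]
      congr 2
      ring
    · refine hv.le_add_coe (hcη i b) ?_
      rw [hv.map_neg, hv.map_mul, add_assoc]
      exact (hcη i b₀).trans (add_le_add_right (hratio b) _)
  exact Finset.notMem_erase b₀ B (hB.le_of_le hsmaller (Finset.erase_subset _ _) hb₀B)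

/-- The tropicalisation of a linear space has a section on the locus of finite points which is
continuous in the weight vector. -/
theorem exists_linear_section (hv : IsVal v)
    (hlin : ∃ S : Set (MvPolynomial ι K), (∀ F ∈ S, F.IsHomogeneous 1) ∧ I = Ideal.span S) :
    ∃ s : (ι → ℝ) → MvPolynomial ι K → RInf, (∀ F, Continuous fun η => s η F) ∧
      ∀ η ∈ TropSet0 v I, IsVal (s η) ∧ (∀ c, s η (C c) = v c) ∧ (∀ F ∈ I, s η F = ⊤) ∧
        ∀ i, s η (X i) = (η i : RInf) := by
  let T := (finite_isCoordBasis I).toFinset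
  have hT : T.Nonempty := by
    obtain ⟨B, c, hc, -⟩ := exists_isCoordBasis_le hv I 0
    exact ⟨c, (Set.Finite.mem_toFinset _).2 ⟨B, hc⟩⟩
  let s : (ι → ℝ) → MvPolynomial ι K → RInf := fun η F =>
    T.sup' hT fun c => gaussPoly v η (linSub c F)
  refine ⟨s, fun F => Continuous.finset_sup'_apply hT fun c _ => continuous_gaussPoly v _,
    fun η hη => ?_⟩
  obtain ⟨B, c, hc, hcη⟩ := exists_isCoordBasis_le hv I η
  have hlinSub : IsVal fun F => gaussPoly v η (linSub c F) :=
    (isVal_gaussPoly hv η).comp (linSub c).toRingHom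
  have hC : ∀ k, gaussPoly v η (linSub c (C k)) = v k := fun k => by
    rw [linSub, aeval_C, algebraMap_eq, gaussPoly_C hv]
  have hXge : ∀ i, (η i : RInf) ≤ gaussPoly v η (linSub c (X i)) := fun i => by
    rw [linSub, aeval_X]
    refine (isVal_gaussPoly hv η).le_sum fun b _ => ?_
    rw [(isVal_gaussPoly hv η).map_mul, gaussPoly_C hv, gaussPoly_X hv]
    exact hcη i b
  have hs : s η = fun F => gaussPoly v η (linSub c F) := by
    funext F
    refine le_antisymm (Finset.sup'_le _ _ fun c' hc' => ?_)
      (Finset.le_sup' (fun c => gaussPoly v η (linSub c F)) (show c ∈ T from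
        (Set.Finite.mem_toFinset _).2 ⟨B, hc⟩))
    obtain ⟨B', hc'⟩ := (Set.Finite.mem_toFinset _).1 hc'
    have h := hc.linSub_eq_zero hlin (hc'.sub_linSub_mem F)
    rw [map_sub, sub_eq_zero] at h
    rw [h]
    exact gaussPoly_le hlinSub hC hXge _
  rw [hs]
  refine ⟨hlinSub, hC, fun F hF => ?_, fun i => le_antisymm ?_ (hXge i)⟩
  · beta_reduce
    rw [hc.linSub_eq_zero hlin hF, (isVal_gaussPoly hv η).map_zero]
  · obtain ⟨w, ⟨hw, hwv⟩, hwη⟩ := hη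
    have h := gaussPoly_le (u := fun F => w (Ideal.Quotient.mk I F))
      (hw.comp (Ideal.Quotient.mk I)) hwv (fun i => (hwη i).ge) (linSub c (X i))
    refine h.trans_eq ?_
    rw [← Ideal.Quotient.eq.2 (hc.sub_linSub_mem (X i))]
    exact hwη i

end Linear

/-- Let `I_Y` be generated by homogeneous linear forms, and let
`I_X = {F : F_β ∈ I_Y for all β}` (the ideal of the torus-smeared linear space).
If there is a continuous decomposition `ξ = Aτ(ξ) + η(ξ)` on `Trop(X⁰)` with
`η(ξ) ∈ Trop(Y⁰)`, then `trop : X^an → Trop(X⁰)` has a continuous section; if the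
decomposition is moreover `ℝ^m`-equivariant, the section can be chosen
`ℝ^m`-equivariant. -/
theorem smearing_section
    {K : Type*} [Field K] (v : K → RInf) (hv : IsVal v)
    (hsurj : Function.Surjective v) {n m : ℕ}
    (IY : Ideal (MvPolynomial (Fin n) K))
    (hlin : ∃ S : Set (MvPolynomial (Fin n) K),
      (∀ F ∈ S, F.IsHomogeneous 1) ∧ IY = Ideal.span S)
    (a : Fin n → Fin m → ℤ)
    (IX : Ideal (MvPolynomial (Fin n) K))
    (hIX : ∀ F : MvPolynomial (Fin n) K,
      F ∈ IX ↔ ∀ β : Fin m → ℤ, wtComp a F β ∈ IY)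
    (τf : (Fin n → ℝ) → Fin m → ℝ) (ηf : (Fin n → ℝ) → Fin n → ℝ)
    (hcont : ContinuousOn (fun ξ => (τf ξ, ηf ξ)) (TropSet0 v IX))
    (hηmem : ∀ ξ ∈ TropSet0 v IX, ηf ξ ∈ TropSet0 v IY)
    (hdecomp : ∀ ξ ∈ TropSet0 v IX, ∀ i, ξ i = pairR (a i) (τf ξ) + ηf ξ i) :
    -- a continuous section exists
    (∃ σ : TropSet0 v IX →
        {w : (MvPolynomial (Fin n) K ⧸ IX) → RInf //
          w ∈ An v (MvPolynomial (Fin n) K ⧸ IX)},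
      Continuous σ ∧
      ∀ ξ : TropSet0 v IX, ∀ i : Fin n,
        tropMap IX (σ ξ).val i = (((ξ : Fin n → ℝ) i : ℝ) : RInf)) ∧
    -- if the decomposition is equivariant, an equivariant section exists
    ((∀ ξ ∈ TropSet0 v IX, ∀ τ' : Fin m → ℝ,
        (fun i => ξ i + pairR (a i) τ') ∈ TropSet0 v IX ∧
        τf (fun i => ξ i + pairR (a i) τ') = τf ξ + τ' ∧
        ηf (fun i => ξ i + pairR (a i) τ') = ηf ξ) →
      ∃ σ : TropSet0 v IX →
          {w : (MvPolynomial (Fin n) K ⧸ IX) → RInf //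
            w ∈ An v (MvPolynomial (Fin n) K ⧸ IX)},
        Continuous σ ∧
        (∀ ξ : TropSet0 v IX, ∀ i : Fin n,
          tropMap IX (σ ξ).val i = (((ξ : Fin n → ℝ) i : ℝ) : RInf)) ∧
        (∀ (ξ : TropSet0 v IX) (τ' : Fin m → ℝ),
          ∃ h : (fun i => (ξ : Fin n → ℝ) i + pairR (a i) τ') ∈ TropSet0 v IX,
            (σ ⟨_, h⟩).val = mu a IX τ' (σ ξ).val)) := by
  obtain ⟨s, hs_cont, hs⟩ := exists_linear_section hv hlin
  let u : (Fin n → ℝ) → MvPolynomial (Fin n) K → RInf := fun ξ =>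
    smear a (s (ηf ξ)) (τf ξ)
  have hsv : ∀ ξ : TropSet0 v IX, IsVal (s (ηf ξ)) := fun ξ => (hs _ (hηmem ξ ξ.2)).1
  have hu : ∀ ξ : TropSet0 v IX, IsVal (u ξ) := fun ξ => isVal_smear (hsv ξ) _
  have huI : ∀ ξ : TropSet0 v IX, ∀ F ∈ IX, u ξ F = ⊤ := fun ξ F hF =>
    smear_eq_top (hs _ (hηmem ξ ξ.2)).2.2.1 _ ((hIX F).1 hF)
  let σ : TropSet0 v IX → {w : (MvPolynomial (Fin n) K ⧸ IX) → RInf //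
      w ∈ An v (MvPolynomial (Fin n) K ⧸ IX)} := fun ξ =>
    ⟨quotVal IX (u ξ), isVal_quotVal (hu ξ) (huI ξ), fun c =>
      (quotVal_mk (hu ξ) (huI ξ) (MvPolynomial.C c)).trans <|
        (smear_C (hsv ξ) _ c).trans ((hs _ (hηmem ξ ξ.2)).2.1 c)⟩
  have hcont' : Continuous fun ξ : TropSet0 v IX => (τf ξ, ηf ξ) :=
    continuousOn_iff_continuous_domRestrict.1 hcont
  have hσ_cont : Continuous σ := by
    refine Continuous.subtype_mk (continuous_pi fun f => ?_) _
    exact continuous_smear (s := fun ξ : TropSet0 v IX => s (ηf ξ))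
      (fun F => (hs_cont F).comp hcont'.snd) hcont'.fst _
  have hσ_trop : ∀ ξ : TropSet0 v IX, ∀ i : Fin n,
      tropMap IX (σ ξ).val i = (((ξ : Fin n → ℝ) i : ℝ) : RInf) := fun ξ i => by
    refine (quotVal_mk (hu ξ) (huI ξ) (MvPolynomial.X i)).trans ?_
    change smear a (s (ηf ξ)) (τf ξ) (MvPolynomial.X i) = _
    rw [smear_X (hsv ξ), (hs _ (hηmem ξ ξ.2)).2.2.2 i, hdecomp ξ ξ.2 i, add_comm (pairR _ _),
      WithTop.coe_add]
  refine ⟨⟨σ, hσ_cont, hσ_trop⟩, fun hequiv => ⟨σ, hσ_cont, hσ_trop, fun ξ τ' => ?_⟩⟩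
  obtain ⟨hmem, hτ, hη⟩ := hequiv ξ ξ.2 τ'
  refine ⟨hmem, funext fun f => ?_⟩
  have hmk : (fun G => (σ ξ).val (Ideal.Quotient.mk IX G)) = u ξ :=
    funext fun G => quotVal_mk (hu ξ) (huI ξ) G
  rw [mu, muAux_eq_gaussVal a (σ ξ).2.1, hmk]
  change smear a (s (ηf _)) (τf _) _ = smear a (smear a (s (ηf ξ)) (τf ξ)) τ' _
  rw [hτ, hη, smear_add (hsv ξ)]
end

section
/- Let K be a field with a surjective additive valuation v : K → ℝ∞, let m, p ≥ 1, and let I ⊆ K[x_{ij} : 1 ≤ i ≤ m, 1 ≤ j ≤ p] be the kernel of the K-algebra homomorphism into K[y_1,…,y_m,z_1,…,z_p] sending x_{ij} ↦ y_i − z_j, with B := K[x]/I and Trop(Y) := {(w(x̄_{ij}))_{ij} : w an additive valuation on B extending v}. Then a point η ∈ (ℝ∞)^{m×p} lies in Trop(Y) if and only if in every 2×2 submatrix of η the minimal entry appears at least twice: for all 1 ≤ i < l ≤ m and 1 ≤ j < k ≤ p, the minimum of the four values η_{ij}, η_{ik}, η_{lj}, η_{lk} is attained at least twice. -/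
open scoped Classical

/-- The minimum of four values in `ℝ∞` is attained at least twice. -/
def TwiceMin4 (x y z u : RInf) : Prop :=
  ∃ p q : Fin 4, p ≠ q ∧
    ![x, y, z, u] p = min (min x y) (min z u) ∧
    ![x, y, z, u] q = min (min x y) (min z u)

/-- The ideal of the linear space parameterised by `x_{ij} = y_i − z_j`: the kernel
of the homomorphism `x_{ij} ↦ y_i − z_j`. -/
noncomputable def diffIdeal2 (K : Type*) [Field K] (m p : ℕ) :
    Ideal (MvPolynomial (Fin m × Fin p) K) :=
  RingHom.ker (MvPolynomial.aeval (fun e : Fin m × Fin p =>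
    (MvPolynomial.X (Sum.inl e.1) - MvPolynomial.X (Sum.inr e.2)
      : MvPolynomial (Fin m ⊕ Fin p) K)))

universe u

/-- The additive valuation given by a map satisfying `IsVal`. -/
noncomputable def IsVal.toAddValuation {R : Type*} [CommRing R] {w : R → RInf} (hw : IsVal w) :
    AddValuation R RInf :=
  AddValuation.of w hw.map_zero hw.map_one hw.min_le_add hw.map_mul

theorem AddValuation.isVal {R : Type*} [CommRing R] (w : AddValuation R RInf) : IsVal w :=
  ⟨w.map_mul, w.map_add, w.map_one, w.map_zero⟩

/-- The minimum of four values is attained at least twice iff each value is at least the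
minimum of the other three. -/
theorem twiceMin4_iff (x y z u : RInf) :
    TwiceMin4 x y z u ↔ min (min y z) u ≤ x ∧ min (min x z) u ≤ y ∧
      min (min x y) u ≤ z ∧ min (min x y) z ≤ u := by
  constructor
  · rintro ⟨p, q, hne, hp, hq⟩
    fin_cases p <;> fin_cases q <;> simp at hne hp hq ⊢ <;> grind
  · intro h
    have key : (x = min (min x y) (min z u) ∧ y = min (min x y) (min z u)) ∨
        (x = min (min x y) (min z u) ∧ z = min (min x y) (min z u)) ∨
        (x = min (min x y) (min z u) ∧ u = min (min x y) (min z u)) ∨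
        (y = min (min x y) (min z u) ∧ z = min (min x y) (min z u)) ∨
        (y = min (min x y) (min z u) ∧ u = min (min x y) (min z u)) ∨
        (z = min (min x y) (min z u) ∧ u = min (min x y) (min z u)) := by
      grind
    rcases key with h | h | h | h | h | h
    · exact ⟨0, 1, by decide, h.1, h.2⟩
    · exact ⟨0, 2, by decide, h.1, h.2⟩
    · exact ⟨0, 3, by decide, h.1, h.2⟩
    · exact ⟨1, 2, by decide, h.1, h.2⟩
    · exact ⟨1, 3, by decide, h.1, h.2⟩
    · exact ⟨2, 3, by decide, h.1, h.2⟩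

theorem forall_twiceMin4_iff {α β : Type*} [LinearOrder α] [LinearOrder β] (η : α × β → RInf) :
    (∀ i l : α, ∀ j k : β, i < l → j < k →
        TwiceMin4 (η (i, j)) (η (i, k)) (η (l, j)) (η (l, k))) ↔
      ∀ i l : α, ∀ j k : β, min (min (η (i, j)) (η (i, k))) (η (l, j)) ≤ η (l, k) := by
  simp only [twiceMin4_iff]
  constructor
  · intro h i l j k
    rcases lt_trichotomy i l with hil | rfl | hil
    · rcases lt_trichotomy j k with hjk | rfl | hjk
      · have := h i l j k hil hjk
        grind
      · simp
      · have := h i l k j hil hjk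
        grind
    · simp
    · rcases lt_trichotomy j k with hjk | rfl | hjk
      · have := h l i j k hil hjk
        grind
      · simp
      · have := h l i k j hil hjk
        grind
  · intro h i l j k _ _
    have h1 := h i l j k
    have h2 := h i l k j
    have h3 := h l i j k
    have h4 := h l i k j
    grind

namespace AddValuation

open Polynomial

section Gauss

variable {R : Type*} [CommRing R] (w : AddValuation R RInf) (ρ : ℝ)

theorem exists_map_le_map_sum {α : Type*} {s : Finset α} (hs : s.Nonempty) (f : α → R) :
    ∃ i ∈ s, w (f i) ≤ w (∑ i ∈ s, f i) := by
  by_contra! h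
  obtain ⟨i, hi⟩ := hs
  exact lt_irrefl _ (w.map_lt_sum (h i hi).ne_top h)

/-- The value of the degree `k` term of `f` when the variable has value `ρ`. -/
noncomputable def termVal (f : R[X]) (k : ℕ) : RInf :=
  w (f.coeff k) + ((k * ρ : ℝ) : RInf)

/-- The underlying map of the Gauss valuation of radius `ρ`. -/
noncomputable def gaussFun (f : R[X]) : RInf :=
  f.support.inf (termVal w ρ f)

variable {w ρ}

theorem le_gaussFun_iff {f : R[X]} {c : RInf} :
    c ≤ gaussFun w ρ f ↔ ∀ k, c ≤ termVal w ρ f k := by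
  rw [gaussFun, Finset.le_inf_iff]
  refine ⟨fun h k => ?_, fun h k _ => h k⟩
  by_cases hk : k ∈ f.support
  · exact h k hk
  · simp [termVal, notMem_support_iff.mp hk]

theorem gaussFun_le_termVal (f : R[X]) (k : ℕ) : gaussFun w ρ f ≤ termVal w ρ f k :=
  le_gaussFun_iff.mp le_rfl k

theorem exists_min_eq_gaussFun {f : R[X]} (hf : gaussFun w ρ f ≠ ⊤) :
    ∃ i, termVal w ρ f i = gaussFun w ρ f ∧ ∀ j < i, gaussFun w ρ f < termVal w ρ f j := by
  have h : ∃ i, termVal w ρ f i = gaussFun w ρ f := by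
    have hs : f.support.Nonempty := by
      by_contra hs
      rw [Finset.not_nonempty_iff_eq_empty] at hs
      simp [gaussFun, hs] at hf
    obtain ⟨i, _, hi⟩ := Finset.exists_mem_eq_inf _ hs (termVal w ρ f)
    exact ⟨i, hi.symm⟩
  exact ⟨Nat.find h, Nat.find_spec h, fun j hj =>
    lt_of_le_of_ne (gaussFun_le_termVal f j) (Ne.symm (Nat.find_min h hj))⟩

theorem map_coeff_mul_coeff_add (f g : R[X]) (k l : ℕ) :
    w (f.coeff k * g.coeff l) + (((k + l : ℕ) * ρ : ℝ) : RInf) =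
      termVal w ρ f k + termVal w ρ g l := by
  rw [w.map_mul, termVal, termVal, Nat.cast_add, add_mul, WithTop.coe_add, add_add_add_comm]

theorem gaussFun_add_le_gaussFun_mul (f g : R[X]) :
    gaussFun w ρ f + gaussFun w ρ g ≤ gaussFun w ρ (f * g) := by
  refine le_gaussFun_iff.mpr fun n => ?_
  obtain ⟨⟨k, l⟩, hkl, hle⟩ := w.exists_map_le_map_sum
    (⟨(0, n), by simp⟩ : (Finset.HasAntidiagonal.antidiagonal n).Nonempty)
    (fun x : ℕ × ℕ => f.coeff x.1 * g.coeff x.2)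
  rw [← coeff_mul] at hle
  rw [Finset.HasAntidiagonal.mem_antidiagonal] at hkl
  subst hkl
  calc gaussFun w ρ f + gaussFun w ρ g ≤ termVal w ρ f k + termVal w ρ g l :=
        add_le_add (gaussFun_le_termVal f k) (gaussFun_le_termVal g l)
    _ = _ := (map_coeff_mul_coeff_add f g k l).symm
    _ ≤ _ := by
        rw [termVal]
        gcongr

theorem gaussFun_mul (f g : R[X]) :
    gaussFun w ρ (f * g) = gaussFun w ρ f + gaussFun w ρ g := by
  refine le_antisymm ?_ (gaussFun_add_le_gaussFun_mul f g)
  by_cases hf : gaussFun w ρ f = ⊤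
  · simp [hf]
  by_cases hg : gaussFun w ρ g = ⊤
  · simp [hg]
  obtain ⟨i, hi, hi'⟩ := exists_min_eq_gaussFun hf
  obtain ⟨j, hj, hj'⟩ := exists_min_eq_gaussFun hg
  have hij : (i, j) ∈ Finset.HasAntidiagonal.antidiagonal (i + j) := by simp
  have hval : w (f.coeff i * g.coeff j) + (((i + j : ℕ) * ρ : ℝ) : RInf) =
      gaussFun w ρ f + gaussFun w ρ g := by
    rw [map_coeff_mul_coeff_add, hi, hj]
  have htop : w (f.coeff i * g.coeff j) ≠ ⊤ := by
    intro h
    rw [h, top_add] at hval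
    exact WithTop.add_ne_top.mpr ⟨hf, hg⟩ hval.symm
  have hlt : w (f.coeff i * g.coeff j) <
      w (∑ x ∈ (Finset.HasAntidiagonal.antidiagonal (i + j)).erase (i, j), f.coeff x.1 * g.coeff x.2) := by
    refine w.map_lt_sum htop fun x hx => ?_
    obtain ⟨k, l⟩ := x
    simp only [Finset.mem_erase, Finset.HasAntidiagonal.mem_antidiagonal, ne_eq, Prod.mk.injEq] at hx
    refine lt_of_add_lt_add_right (a := (((i + j : ℕ) * ρ : ℝ) : RInf)) ?_
    rw [hval, ← hx.2, map_coeff_mul_coeff_add]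
    rcases lt_or_ge k i with hk | hk
    · exact WithTop.add_lt_add_of_lt_of_le hg (hi' k hk) (gaussFun_le_termVal g l)
    · exact WithTop.add_lt_add_of_le_of_lt hf (gaussFun_le_termVal f k) (hj' l (by omega))
  refine (gaussFun_le_termVal (f * g) (i + j)).trans_eq ?_
  rw [termVal, coeff_mul, ← Finset.add_sum_erase _ _ hij, w.map_add_eq_of_lt_left hlt, hval]

variable (w ρ)

/-- The Gauss valuation of radius `ρ` on `R[X]`. -/
noncomputable def gauss : AddValuation R[X] RInf :=
  AddValuation.of (gaussFun w ρ) (by simp [gaussFun])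
    (by
      refine le_antisymm ((gaussFun_le_termVal 1 0).trans (by simp [termVal])) ?_
      refine le_gaussFun_iff.mpr fun k => ?_
      rcases k with _ | k <;> simp [termVal, coeff_one])
    (fun f g => le_gaussFun_iff.mpr fun k => by
      have hf := gaussFun_le_termVal (w := w) (ρ := ρ) f k
      have hg := gaussFun_le_termVal (w := w) (ρ := ρ) g k
      rw [termVal] at hf hg ⊢
      rw [coeff_add]
      calc _ ≤ min (w (f.coeff k) + ((k * ρ : ℝ) : RInf)) (w (g.coeff k) + ((k * ρ : ℝ) : RInf)) :=
            min_le_min hf hg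
        _ = min (w (f.coeff k)) (w (g.coeff k)) + ((k * ρ : ℝ) : RInf) := min_add_add_right _ _ _
        _ ≤ _ := by
            gcongr
            exact w.map_add _ _)
    gaussFun_mul

theorem gauss_C_sub_X (b : R) : gauss w ρ (C b - X) = min (w b) ρ := by
  change gaussFun w ρ (C b - X) = _
  refine le_antisymm (le_min ?_ ?_) (le_gaussFun_iff.mpr fun k => ?_)
  · exact (gaussFun_le_termVal _ 0).trans (by simp [termVal])
  · exact (gaussFun_le_termVal _ 1).trans (by simp [termVal])
  · rcases k with _ | _ | k
    · simp [termVal]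
    · simp [termVal]
    · simp [termVal, coeff_X]

theorem gauss_C (b : R) : gauss w ρ (C b) = w b := by
  change gaussFun w ρ (C b) = _
  refine le_antisymm ((gaussFun_le_termVal _ 0).trans (by simp [termVal]))
    (le_gaussFun_iff.mpr fun k => ?_)
  rcases k with _ | k <;> simp [termVal, coeff_C]

end Gauss

/-- Adjoining a generic point of the disc with centre `c` and radius `ρ`. -/
theorem exists_generic_point {R : Type u} [CommRing R] (w : AddValuation R RInf) (c : R)
    (ρ : RInf) :
    ∃ (S : Type u) (_ : CommRing S) (w' : AddValuation S RInf) (f : R →+* S) (x : S),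
      (∀ a, w' (f a) = w a) ∧ ∀ a, w' (f a - x) = min (w (a - c)) ρ := by
  induction ρ using WithTop.recTopCoe with
  | top => exact ⟨R, _, w, RingHom.id R, c, by simp, by simp⟩
  | coe ρ =>
    refine ⟨R[X], inferInstance, gauss w ρ, C, C c + X, gauss_C w ρ, fun a => ?_⟩
    rw [← gauss_C_sub_X, C_sub, sub_sub]

/-- A finite ultrametric is realised by differences of points in a valued extension. -/
theorem exists_points_of_ultrametric {A : Type u} [CommRing A] (v : AddValuation A RInf)
    {α : Type*} (d : α → α → RInf) (hd : ∀ a b, d a b = d b a)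
    (hult : ∀ a b c, min (d a b) (d b c) ≤ d a c) (s : Finset α) :
    ∃ (R : Type u) (_ : CommRing R) (w : AddValuation R RInf) (φ : A →+* R) (t : α → R),
      (∀ c, w (φ c) = v c) ∧ ∀ a ∈ s, ∀ b ∈ s, a ≠ b → w (t a - t b) = d a b := by
  classical
  induction s using Finset.induction_on with
  | empty => exact ⟨A, _, v, RingHom.id A, fun _ => 0, by simp, by simp⟩
  | insert a s ha ih =>
    obtain ⟨R, _, w, φ, t, hφ, ht⟩ := ih
    rcases s.eq_empty_or_nonempty with rfl | hs
    · exact ⟨R, _, w, φ, t, hφ, by simp⟩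
    obtain ⟨r, hr, hmax⟩ := s.exists_max_image (fun b => d b a) hs
    obtain ⟨S, _, w', f, x, hf, hx⟩ := w.exists_generic_point (t r) (d r a)
    have key : ∀ b ∈ s, w' (f (t b) - x) = d b a := by
      intro b hb
      rw [hx]
      by_cases hbr : b = r
      · simp [hbr]
      · rw [ht b hb r hr hbr]
        refine le_antisymm (hult b r a) (le_min ?_ (hmax b hb))
        exact (le_min le_rfl ((hmax b hb).trans_eq (hd r a))).trans (hult b a r)
    refine ⟨S, _, w', f.comp φ, Function.update (f ∘ t) a x, fun c => by simp [hf, hφ], ?_⟩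
    intro b hb c hc hbc
    have hne : ∀ e ∈ s, Function.update (f ∘ t) a x e = f (t e) := fun e he =>
      Function.update_of_ne (ne_of_mem_of_not_mem he ha) _ _
    rcases Finset.mem_insert.mp hb with rfl | hb <;> rcases Finset.mem_insert.mp hc with rfl | hc
    · exact absurd rfl hbc
    · rw [hne c hc, Function.update_self, map_sub_swap, key c hc, hd]
    · rw [hne b ‹_›, Function.update_self, key b ‹_›]
    · rw [hne b hb, hne c hc, ← _root_.map_sub, hf, ht b hb c hc hbc]

/-- A matrix in which every `2 × 2` submatrix attains its minimum twice is realised by differences of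
points in a valued extension. -/
theorem exists_points_of_bipartite {A : Type u} [CommRing A] (v : AddValuation A RInf)
    {α β : Type*} [Fintype α] [Nonempty α] [Fintype β] [Nonempty β] (η : α × β → RInf)
    (hη : ∀ i l : α, ∀ j k : β, min (min (η (i, j)) (η (i, k))) (η (l, j)) ≤ η (l, k)) :
    ∃ (R : Type u) (_ : CommRing R) (w : AddValuation R RInf) (φ : A →+* R) (t : α → R)
      (z : β → R), (∀ c, w (φ c) = v c) ∧ ∀ i j, w (t i - z j) = η (i, j) := by
  classical
  obtain ⟨d, hd⟩ : ∃ d : α → α → RInf,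
      ∀ i l r, r ≤ d i l ↔ ∃ j, r ≤ η (i, j) ∧ r ≤ η (l, j) :=
    ⟨fun i l => Finset.univ.sup' Finset.univ_nonempty fun j => min (η (i, j)) (η (l, j)),
      fun i l r => by simp [Finset.le_sup'_iff]⟩
  have hsymm : ∀ a b, d a b = d b a := fun a b =>
    eq_of_forall_le_iff fun r => by simp only [hd, and_comm]
  have hult : ∀ a b c, min (d a b) (d b c) ≤ d a c := by
    intro a b c
    refine le_of_forall_le fun r hr => ?_
    rw [le_min_iff, hd, hd] at hr
    obtain ⟨⟨j, haj, hbj⟩, k, hbk, hck⟩ := hr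
    exact (hd a c r).mpr ⟨k, (le_min (le_min hbj hbk) haj).trans (hη b a j k), hck⟩
  suffices h : ∀ s : Finset β, ∃ (R : Type u) (_ : CommRing R) (w : AddValuation R RInf)
      (φ : A →+* R) (t : α → R) (z : β → R), (∀ c, w (φ c) = v c) ∧
      (∀ i l, i ≠ l → w (t i - t l) = d i l) ∧ ∀ j ∈ s, ∀ i, w (t i - z j) = η (i, j) by
    obtain ⟨R, _, w, φ, t, z, hφ, _, hz⟩ := h Finset.univ
    exact ⟨R, _, w, φ, t, z, hφ, fun i j => hz j (Finset.mem_univ j) i⟩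
  intro s
  induction s using Finset.induction_on with
  | empty =>
    obtain ⟨R, _, w, φ, t, hφ, ht⟩ := v.exists_points_of_ultrametric d hsymm hult Finset.univ
    exact ⟨R, _, w, φ, t, fun _ => 0, hφ, by simpa using ht, by simp⟩
  | insert j s hj ih =>
    obtain ⟨R, _, w, φ, t, z, hφ, ht, hz⟩ := ih
    obtain ⟨r, hmax⟩ := Finite.exists_max fun i => η (i, j)
    obtain ⟨S, _, w', f, x, hf, hx⟩ := w.exists_generic_point (t r) (η (r, j))
    refine ⟨S, _, w', f.comp φ, f ∘ t, Function.update (f ∘ z) j x, fun c => by simp [hf, hφ],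
      fun i l hil => ?_, fun k hk i => ?_⟩
    · rw [Function.comp_apply, Function.comp_apply, ← _root_.map_sub, hf, ht i l hil]
    rcases Finset.mem_insert.mp hk with rfl | hk
    · rw [Function.update_self, Function.comp_apply, hx]
      by_cases hir : i = r
      · simp [hir]
      rw [ht i r hir]
      refine le_antisymm (le_of_forall_le fun c hc => ?_)
        (le_min ((hd i r _).mpr ⟨k, le_rfl, hmax i⟩) (hmax i))
      rw [le_min_iff, hd] at hc
      obtain ⟨⟨l, hil, hrl⟩, hrk⟩ := hc
      exact (le_min (le_min hrl hrk) hil).trans (hη r i l k)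
    · rw [Function.update_of_ne (ne_of_mem_of_not_mem hk hj), Function.comp_apply, Function.comp_apply,
        ← _root_.map_sub, hf, hz k hk]

end AddValuation

theorem mk_X_eq_of_diffIdeal2 (K : Type*) [Field K] {m p : ℕ} (i l : Fin m) (j k : Fin p) :
    Ideal.Quotient.mk (diffIdeal2 K m p) (MvPolynomial.X (l, k)) =
      Ideal.Quotient.mk (diffIdeal2 K m p) (MvPolynomial.X (i, k)) +
        Ideal.Quotient.mk (diffIdeal2 K m p) (MvPolynomial.X (l, j)) -
        Ideal.Quotient.mk (diffIdeal2 K m p) (MvPolynomial.X (i, j)) := by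
  rw [← map_add, ← map_sub, Ideal.Quotient.eq, diffIdeal2, RingHom.mem_ker]
  simp only [map_sub, map_add, MvPolynomial.aeval_X]
  ring

/-- A point `η ∈ ℝ∞^{m×p}` lies in the tropicalisation of the
linear space `{x_{ij} = y_i − z_j}` if and only if in every `2×2` submatrix of `η`
the minimal entry appears at least twice. -/
theorem trop_of_bipartite_linear_space
    {K : Type*} [Field K] (v : K → RInf) (hv : IsVal v)
    (hsurj : Function.Surjective v) (m p : ℕ) (hm : 1 ≤ m) (hp : 1 ≤ p)
    (η : Fin m × Fin p → RInf) :
    η ∈ TropSet v (diffIdeal2 K m p) ↔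
      ∀ i l : Fin m, ∀ j k : Fin p, i < l → j < k →
        TwiceMin4 (η (i, j)) (η (i, k)) (η (l, j)) (η (l, k)) := by
  rw [forall_twiceMin4_iff]
  constructor
  · rintro ⟨w, ⟨hw, -⟩, rfl⟩ i l j k
    set w' := hw.toAddValuation
    change min (min (w' _) (w' _)) (w' _) ≤ w' _
    rw [mk_X_eq_of_diffIdeal2 K i l j k]
    refine le_trans ?_ (w'.map_sub _ _)
    refine le_min (le_trans ?_ (w'.map_add _ _)) ?_
    · exact le_min ((min_le_left _ _).trans (min_le_right _ _)) (min_le_right _ _)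
    · exact (min_le_left _ _).trans (min_le_left _ _)
  · intro hη
    have : NeZero m := ⟨by omega⟩
    have : NeZero p := ⟨by omega⟩
    obtain ⟨R, _, w, φ, t, z, hφ, hw⟩ := hv.toAddValuation.exists_points_of_bipartite η hη
    let ev : MvPolynomial (Fin m × Fin p) K →+* R :=
      MvPolynomial.eval₂Hom φ fun e => t e.1 - z e.2
    have hev : ev = (MvPolynomial.eval₂Hom φ (Sum.elim t z)).comp
        (MvPolynomial.aeval (fun e : Fin m × Fin p =>
          (MvPolynomial.X (Sum.inl e.1) - MvPolynomial.X (Sum.inr e.2)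
            : MvPolynomial (Fin m ⊕ Fin p) K))).toRingHom := by
      refine MvPolynomial.ringHom_ext (fun c => ?_) fun e => ?_ <;> simp [ev]
    have hker : ∀ F ∈ diffIdeal2 K m p, ev F = 0 := by
      intro F hF
      rw [diffIdeal2, RingHom.mem_ker] at hF
      rw [hev, RingHom.comp_apply]
      exact (congrArg _ hF).trans (map_zero _)
    let ψ := Ideal.Quotient.lift (diffIdeal2 K m p) ev hker
    refine ⟨w.comap ψ, ⟨(w.comap ψ).isVal, fun c => ?_⟩, funext fun e => ?_⟩
    · refine Eq.trans ?_ (hφ c)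
      change w (ev (MvPolynomial.C c)) = _
      simp [ev]
    · refine Eq.trans ?_ (hw e.1 e.2)
      change w (ev (MvPolynomial.X e)) = _
      simp [ev]
end
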